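/- Let i, j be integers with j ≥ 2 and 1 ≤ i ≤ 2j−1. Consider pairs (a,b) of Laurent polynomials with a supported in degrees [−j−i+3, j−1] and b supported in degrees [−j+i+1, j−1]; identify such a pair with its coefficient vector in ℂ^{4j−4} (there are 2j+i−3 coefficients for a and 2j−i−1 for b). Then the map sending a nonzero such pair to the isomorphism class of T_{a,b} = [[z^j, u₁·a + u₂·b],[0, z^{−j}]] descends to a well-defined bijection from ℙ^{4j−5} = ℙ(ℂ^{4j−4}) onto the set of isomorphism classes of matrices T_{a,b} with (a,b) ≠ 0 supported as above. (This identifies the moduli space 𝔐¹_j(W_i, 0) of nontrivial first-order deformations of O(j) ⊕ O(−j) on W_i with ℙ^{4j−5}.) -/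

import Mathlib

open LaurentPolynomial

noncomputable section

/-- The ring `S = ℂ[z,z⁻¹][u₁,u₂]/(u₁,u₂)²`, with `u₁ = inr (1,0)` and `u₂ = inr (0,1)`. -/
abbrev RW : Type :=
  TrivSqZeroExt (LaurentPolynomial ℂ) (LaurentPolynomial ℂ × LaurentPolynomial ℂ)

/-- `p` is a Laurent polynomial supported in degrees `l` with `a ≤ l ≤ b`. -/
def SuppIcc (a b : ℤ) (p : LaurentPolynomial ℂ) : Prop :=
  ∃ c : ℤ → ℂ, p = ∑ l ∈ Finset.Icc a b, c l • T l

/-- `p` lies in `ℂ[z] ⊆ ℂ[z,z⁻¹]`. -/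
def InPolyZ (p : LaurentPolynomial ℂ) : Prop := ∃ N : ℤ, SuppIcc 0 N p

/-- `p` lies in `z^m·ℂ[z⁻¹]`, i.e. is supported in degrees `≤ m`. -/
def SuppLe (m : ℤ) (p : LaurentPolynomial ℂ) : Prop := ∃ N : ℤ, SuppIcc N m p

/-- The subring `O_U = { f(z) + g₁(z)·u₁ + g₂(z)·u₂ }` of `S`. -/
def OUW : Set RW := { x | InPolyZ x.fst ∧ InPolyZ x.snd.1 ∧ InPolyZ x.snd.2 }

/-- The subring `O_V = { f(z⁻¹) + g₁(z⁻¹)·z^{2-i}·u₁ + g₂(z⁻¹)·zⁱ·u₂ }` of `S`. -/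
def OVW (i : ℤ) : Set RW :=
  { x | SuppLe 0 x.fst ∧ SuppLe (2 - i) x.snd.1 ∧ SuppLe i x.snd.2 }

/-- Two 2×2 matrices `T`, `T'` over a ring `A` are isomorphic with respect to
subrings (given as subsets) `SU`, `SV` if `T'·M = N·T` for some matrices `M` (entries
in `SU`) and `N` (entries in `SV`), each invertible with inverse entries in the
same subring. -/
def MatIso {A : Type*} [Ring A] (SU SV : Set A)
    (T T' : Matrix (Fin 2) (Fin 2) A) : Prop :=
  ∃ M M' N N' : Matrix (Fin 2) (Fin 2) A,
    (∀ a b, M a b ∈ SU) ∧ (∀ a b, M' a b ∈ SU) ∧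
    (∀ a b, N a b ∈ SV) ∧ (∀ a b, N' a b ∈ SV) ∧
    M * M' = 1 ∧ M' * M = 1 ∧ N * N' = 1 ∧ N' * N = 1 ∧
    T' * M = N * T

/-- The transition matrix `[[z^{d₁}, u₁·a + u₂·b],[0, z^{d₂}]]` over `S`. -/
def TmatW (d₁ d₂ : ℤ) (a b : LaurentPolynomial ℂ) : Matrix (Fin 2) (Fin 2) RW :=
  !![TrivSqZeroExt.inl (T d₁), TrivSqZeroExt.inr (a, b);
     0, TrivSqZeroExt.inl (T d₂)]

/-- The pair of Laurent polynomials `(a,b)` with `a` supported in degrees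
`[-j-i+3, j-1]` and `b` supported in degrees `[-j+i+1, j-1]`, with coefficient
vector `v ∈ ℂ^{2j+i-3} × ℂ^{2j-i-1} = ℂ^{4j-4}`. -/
def pairOf0 (i j : ℤ)
    (v : (Fin (2 * j + i - 3).toNat → ℂ) × (Fin (2 * j - i - 1).toNat → ℂ)) :
    LaurentPolynomial ℂ × LaurentPolynomial ℂ :=
  (∑ t : Fin (2 * j + i - 3).toNat, v.1 t • T (-j - i + 3 + (t : ℤ)),
   ∑ t : Fin (2 * j - i - 1).toNat, v.2 t • T (-j + i + 1 + (t : ℤ)))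

/-- Isomorphism of the transition matrices `T_{a,b} = [[z^j, u₁·a + u₂·b],[0, z^{-j}]]`,
as a relation on nonzero coefficient vectors. -/
def relW0 (i j : ℤ)
    (v w : {v : (Fin (2 * j + i - 3).toNat → ℂ) × (Fin (2 * j - i - 1).toNat → ℂ) // v ≠ 0}) :
    Prop :=
  MatIso OUW (OVW i)
    (TmatW j (-j) (pairOf0 i j v).1 (pairOf0 i j v).2)
    (TmatW j (-j) (pairOf0 i j w).1 (pairOf0 i j w).2)

theorem SuppIcc.coeff_eq_zero {a b n : ℤ} {p : LaurentPolynomial ℂ} (h : SuppIcc a b p)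
    (hn : n < a ∨ b < n) : p.coeff n = 0 := by
  obtain ⟨c, rfl⟩ := h
  simp only [AddMonoidAlgebra.coeff_sum, AddMonoidAlgebra.coeff_smul, Finsupp.finsetSum_apply,
    Finsupp.smul_apply, T_apply]
  refine Finset.sum_eq_zero fun l hl => ?_
  rw [Finset.mem_Icc] at hl
  rw [if_neg (by omega), smul_zero]

theorem InPolyZ.coeff_eq_zero {n : ℤ} {p : LaurentPolynomial ℂ} (h : InPolyZ p) (hn : n < 0) :
    p.coeff n = 0 :=
  h.choose_spec.coeff_eq_zero (Or.inl hn)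

theorem SuppLe.coeff_eq_zero {m n : ℤ} {p : LaurentPolynomial ℂ} (h : SuppLe m p) (hn : m < n) :
    p.coeff n = 0 :=
  h.choose_spec.coeff_eq_zero (Or.inr hn)

theorem suppIcc_zero (a b : ℤ) : SuppIcc a b 0 := ⟨0, by simp⟩

theorem suppIcc_C (c : ℂ) : SuppIcc 0 0 (C c) :=
  ⟨fun _ => c, by simp [smul_eq_C_mul]⟩

theorem coeff_T_mul (m n : ℤ) (p : LaurentPolynomial ℂ) : (T m * p).coeff n = p.coeff (n - m) := by
  rw [T, AddMonoidAlgebra.coeff_single_mul_eq_mul_coeff (n - m) (fun k _ => by omega), one_mul]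

theorem coeff_mul_T (m n : ℤ) (p : LaurentPolynomial ℂ) : (p * T m).coeff n = p.coeff (n - m) := by
  rw [← T_mul, coeff_T_mul]

theorem eq_C_of_coeff {p : LaurentPolynomial ℂ} (h : ∀ n ≠ 0, p.coeff n = 0) :
    p = C (p.coeff 0) := by
  ext n
  rw [C_apply]
  split_ifs with hn
  · rw [hn]
  · exact h n hn

theorem eq_C_of_inPolyZ_of_suppLe {p : LaurentPolynomial ℂ} (h : InPolyZ p) (h' : SuppLe 0 p) :
    p = C (p.coeff 0) :=
  eq_C_of_coeff fun _ hn => (lt_or_gt_of_ne hn).elim h.coeff_eq_zero h'.coeff_eq_zero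

theorem coeff_eq_div_mul {j n : ℤ} {α δ : ℂ} (hδ : δ ≠ 0) {p p' x y : LaurentPolynomial ℂ}
    (h : x * T j + p' * C δ = C α * p + y * T (-j)) (hx : x.coeff (n - j) = 0)
    (hy : y.coeff (n - -j) = 0) : p'.coeff n = α / δ * p.coeff n := by
  have := congrArg (fun q => q.coeff n) h
  rw [mul_comm p', ← smul_eq_C_mul, ← smul_eq_C_mul] at this
  simp only [AddMonoidAlgebra.coeff_add, AddMonoidAlgebra.coeff_smul, Finsupp.add_apply,
    Finsupp.smul_apply, coeff_mul_T, hx, hy, smul_eq_mul, zero_add, add_zero] at this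
  field_simp
  linear_combination this

/-- An isomorphism between two transition matrices forces their off-diagonal entries to agree up
to a nonzero scalar in the degrees not absorbed by the two charts. -/
theorem exists_scalar_of_matIso {i j : ℤ} (hj : 0 < j) {a b a' b' : LaurentPolynomial ℂ}
    (h : MatIso OUW (OVW i) (TmatW j (-j) a b) (TmatW j (-j) a' b')) :
    ∃ c : ℂ, c ≠ 0 ∧ (∀ n, 2 - i - j < n → n < j → a'.coeff n = c * a.coeff n) ∧
      ∀ n, i - j < n → n < j → b'.coeff n = c * b.coeff n := by
  obtain ⟨M, M', N, N', hM, -, hN, -, hMM', hM'M, -, -, hT⟩ := h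
  have m00 := congrArg TrivSqZeroExt.fst (congrFun₂ hT 0 0)
  have e01 := congrArg TrivSqZeroExt.fst (congrFun₂ hT 0 1)
  have m11 := congrArg TrivSqZeroExt.fst (congrFun₂ hT 1 1)
  have s1 := congrArg (fun x : RW => x.snd.1) (congrFun₂ hT 0 1)
  have s2 := congrArg (fun x : RW => x.snd.2) (congrFun₂ hT 0 1)
  simp [TmatW, Matrix.mul_apply, Fin.sum_univ_two, (isUnit_T _).ne_zero] at m00 e01 m11 s1 s2
  have m01 : (M 0 1).fst = 0 := by
    ext n
    have := congrArg (fun p => p.coeff (n + j)) e01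
    simp only [coeff_mul_T, add_sub_cancel_right] at this
    rcases lt_or_ge n 0 with hn | hn
    · exact (hM 0 1).1.coeff_eq_zero hn
    · rw [this, (hN 0 1).1.coeff_eq_zero (by omega)]
      rfl
  have c00 := eq_C_of_inPolyZ_of_suppLe (m00 ▸ (hM 0 0).1) (hN 0 0).1
  have c11 := eq_C_of_inPolyZ_of_suppLe (hM 1 1).1 (m11 ▸ (hN 1 1).1)
  set α := (N 0 0).fst.coeff 0
  set δ := (M 1 1).fst.coeff 0
  have hα : α ≠ 0 := by
    intro h0
    have := congrArg TrivSqZeroExt.fst (congrFun₂ hMM' 0 0)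
    simp [Matrix.mul_apply, Fin.sum_univ_two, m01, m00, c00, h0] at this
  have hδ : δ ≠ 0 := by
    intro h0
    have := congrArg TrivSqZeroExt.fst (congrFun₂ hM'M 1 1)
    simp [Matrix.mul_apply, Fin.sum_univ_two, m01, c11, h0] at this
  rw [c00, c11] at s1 s2
  refine ⟨α / δ, div_ne_zero hα hδ, fun n hn hn' => ?_, fun n hn hn' => ?_⟩
  · exact coeff_eq_div_mul hδ s1 ((hM 0 1).2.1.coeff_eq_zero (by omega))
      ((hN 0 1).2.1.coeff_eq_zero (by omega))
  · exact coeff_eq_div_mul hδ s2 ((hM 0 1).2.2.coeff_eq_zero (by omega))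
      ((hN 0 1).2.2.coeff_eq_zero (by omega))

theorem matIso_smul {i d₁ d₂ : ℤ} {c : ℂ} (hc : c ≠ 0) (a b : LaurentPolynomial ℂ) :
    MatIso OUW (OVW i) (TmatW d₁ d₂ a b) (TmatW d₁ d₂ (c • a) (c • b)) := by
  have hU : ∀ (x : ℂ) (k l : Fin 2),
      (!![TrivSqZeroExt.inl (C x), 0; 0, 1] : Matrix (Fin 2) (Fin 2) RW) k l ∈ OUW := by
    have h0 : InPolyZ 0 := ⟨0, suppIcc_zero 0 0⟩
    have h1 : InPolyZ 1 := ⟨0, by simpa using suppIcc_C 1⟩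
    have hx (x : ℂ) : InPolyZ (C x) := ⟨0, suppIcc_C x⟩
    intro x k l
    fin_cases k <;> fin_cases l <;> simp [OUW, h0, h1, hx]
  have hV : ∀ (x : ℂ) (k l : Fin 2),
      (!![TrivSqZeroExt.inl (C x), 0; 0, 1] : Matrix (Fin 2) (Fin 2) RW) k l ∈ OVW i := by
    have h0 (m : ℤ) : SuppLe m 0 := ⟨0, suppIcc_zero 0 m⟩
    have h1 : SuppLe 0 1 := ⟨0, by simpa using suppIcc_C 1⟩
    have hx (x : ℂ) : SuppLe 0 (C x) := ⟨0, suppIcc_C x⟩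
    intro x k l
    fin_cases k <;> fin_cases l <;> simp [OVW, h0, h1, hx]
  have hinv : ∀ x y : ℂ, x * y = 1 →
      (!![TrivSqZeroExt.inl (C x), 0; 0, 1] : Matrix (Fin 2) (Fin 2) RW) *
        !![TrivSqZeroExt.inl (C y), 0; 0, 1] = 1 := by
    intro x y h
    rw [Matrix.mul_fin_two, Matrix.one_fin_two]
    simp [← TrivSqZeroExt.inl_mul, ← map_mul, h]
  refine ⟨_, _, _, _, hU c, hU c⁻¹, hV c, hV c⁻¹, hinv _ _ (mul_inv_cancel₀ hc),
    hinv _ _ (inv_mul_cancel₀ hc), hinv _ _ (mul_inv_cancel₀ hc), hinv _ _ (inv_mul_cancel₀ hc), ?_⟩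
  rw [TmatW, TmatW, Matrix.mul_fin_two, Matrix.mul_fin_two]
  rw [mul_comm (TrivSqZeroExt.inl (T d₁)) (TrivSqZeroExt.inl (C c))]
  refine Matrix.ext fun k l => ?_
  fin_cases k <;> fin_cases l <;> simp [smul_eq_C_mul, TrivSqZeroExt.inl_mul_inr]

theorem coeff_sum_smul_T (m : ℤ) {k : ℕ} (f : Fin k → ℂ) (t : Fin k) :
    (∑ s : Fin k, f s • (T (m + (s : ℤ)) : LaurentPolynomial ℂ)).coeff (m + (t : ℤ)) = f t := by
  simp [AddMonoidAlgebra.coeff_sum, Finsupp.finsetSum_apply, Fin.val_inj]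

theorem pairOf0_smul (i j : ℤ) (c : ℂ)
    (v : (Fin (2 * j + i - 3).toNat → ℂ) × (Fin (2 * j - i - 1).toNat → ℂ)) :
    pairOf0 i j (c • v) = c • pairOf0 i j v := by
  simp [pairOf0, Finset.smul_sum, mul_smul]

theorem relW0_iff {i j : ℤ} (hj : 0 < j)
    (v w : {v : (Fin (2 * j + i - 3).toNat → ℂ) × (Fin (2 * j - i - 1).toNat → ℂ) // v ≠ 0}) :
    relW0 i j v w ↔ ∃ c : ℂ, c ≠ 0 ∧ w.1 = c • v.1 := by
  constructor
  · intro h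
    obtain ⟨c, hc, h1, h2⟩ := exists_scalar_of_matIso hj h
    refine ⟨c, hc, Prod.ext (funext fun t => ?_) (funext fun t => ?_)⟩
    · simpa only [pairOf0, coeff_sum_smul_T, Prod.smul_fst, Pi.smul_apply,
        smul_eq_mul] using
        h1 (-j - i + 3 + (t : ℤ)) (by omega) (by omega)
    · simpa only [pairOf0, coeff_sum_smul_T, Prod.smul_snd, Pi.smul_apply,
        smul_eq_mul] using
        h2 (-j + i + 1 + (t : ℤ)) (by omega) (by omega)
  · rintro ⟨c, hc, h⟩
    rw [relW0, h, pairOf0_smul]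
    exact matIso_smul hc _ _

theorem stmt9 (i j : ℤ) (hj : 2 ≤ j) (hi : 1 ≤ i) (hij : i ≤ 2 * j - 1) :
    ∃ e : Projectivization ℂ
        ((Fin (2 * j + i - 3).toNat → ℂ) × (Fin (2 * j - i - 1).toNat → ℂ)) ≃
        Quot (relW0 i j),
      ∀ (v : (Fin (2 * j + i - 3).toNat → ℂ) × (Fin (2 * j - i - 1).toNat → ℂ)) (hv : v ≠ 0),
        e (Projectivization.mk ℂ v hv) = Quot.mk (relW0 i j) ⟨v, hv⟩ := by
  refine ⟨Quot.congrRight fun v w => ?_, fun v hv => rfl⟩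
  rw [relW0_iff (by omega)]
  constructor
  · rintro ⟨u, hu⟩
    exact ⟨(u⁻¹ : ℂˣ), Units.ne_zero _, by rw [← hu]; exact (inv_smul_smul u _).symm⟩
  · rintro ⟨c, hc, h⟩
    refine ⟨(Units.mk0 c hc)⁻¹, ?_⟩
    change (Units.mk0 c hc)⁻¹ • w.1 = v.1
    rw [h]
    exact inv_smul_smul (Units.mk0 c hc) _
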